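/- Let n ≥ 4 and 1 ≤ p ≤ n−3 be integers and set q = n−p−2. Let G be the double star T(p,q), i.e., the tree on n vertices consisting of two adjacent vertices u and v, with p further pendant vertices adjacent to u and q further pendant vertices adjacent to v. Then the Randić energy of G equals 2 + 2√(p(n−p−2)/((p+1)(n−p−1))). -/

import Mathlib

open Polynomial

open scoped Classical in
/-- The Randić matrix of a simple graph `G`: the `(u,v)` entry is `1/√(d_u d_v)` when `uv` is
an edge and `0` otherwise, where `d_v` is the degree of the vertex `v`. -/
noncomputable def randicMatrix {V : Type*} (G : SimpleGraph V) : Matrix V V ℝ :=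
  Matrix.of fun u v =>
    if G.Adj u v then
      1 / Real.sqrt (((G.neighborSet u).ncard : ℝ) * ((G.neighborSet v).ncard : ℝ))
    else 0

lemma randicMatrix_isHermitian {V : Type*} (G : SimpleGraph V) :
    (randicMatrix G).IsHermitian := by
  ext u v
  by_cases h : G.Adj u v
  · simp [randicMatrix, Matrix.conjTranspose_apply, h, h.symm, mul_comm]
  · have h' : ¬ G.Adj v u := fun hc => h hc.symm
    simp [randicMatrix, Matrix.conjTranspose_apply, h, h']

/-- The Randić energy of a graph: the sum of the absolute values of the eigenvalues of its
Randić matrix. -/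
noncomputable def randicEnergy {V : Type*} [Fintype V] [DecidableEq V] (G : SimpleGraph V) : ℝ :=
  ∑ i, |(randicMatrix_isHermitian G).eigenvalues i|

/-- The caterpillar `T(p 0, …, p (r-1))`: a path `v_0 v_1 ⋯ v_{r-1}` (the `Sum.inl` vertices)
together with, for each `i`, `p i` pendant vertices attached to `v_i` (the `Sum.inr` vertices). -/
def caterpillar (r : ℕ) (p : Fin r → ℕ) :
    SimpleGraph ((Fin r) ⊕ (Σ i : Fin r, Fin (p i))) :=
  SimpleGraph.fromRel (fun u v =>
    (∃ i j : Fin r, u = Sum.inl i ∧ v = Sum.inl j ∧ (i : ℕ) + 1 = (j : ℕ)) ∨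
    (∃ (i : Fin r) (k : Fin (p i)), u = Sum.inl i ∧ v = Sum.inr ⟨i, k⟩))

theorem Matrix.IsHermitian.trace_pow_eq_sum_eigenvalues_pow {V : Type*} [Fintype V]
    [DecidableEq V] {A : Matrix V V ℝ} (hA : A.IsHermitian) (k : ℕ) :
    (A ^ k).trace = ∑ i, hA.eigenvalues i ^ k := by
  conv_lhs => rw [hA.spectral_theorem, ← map_pow, Unitary.conjStarAlgAut_apply,
    Matrix.trace_mul_comm, ← mul_assoc]
  simp [Matrix.diagonal_pow, Matrix.trace]

section DoubleStar

variable (p : Fin 2 → ℕ)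

lemma caterpillar_two_adj_inl_inl (i j : Fin 2) :
    (caterpillar 2 p).Adj (Sum.inl i) (Sum.inl j) ↔ i ≠ j := by
  fin_cases i <;> fin_cases j <;> simp [caterpillar]

lemma caterpillar_adj_inl_inr {r : ℕ} (p : Fin r → ℕ) (i : Fin r) (x : Σ i : Fin r, Fin (p i)) :
    (caterpillar r p).Adj (Sum.inl i) (Sum.inr x) ↔ i = x.1 := by
  obtain ⟨j, k⟩ := x
  simp only [caterpillar, SimpleGraph.fromRel_adj]
  constructor
  · rintro ⟨-, (⟨_, _, _, h, _⟩ | ⟨a, b, h1, h2⟩) | (⟨_, _, h, _⟩ | ⟨a, b, h1, h2⟩)⟩ <;> simp_all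
  · rintro rfl
    exact ⟨by simp, .inl (.inr ⟨_, k, rfl, rfl⟩)⟩

lemma caterpillar_not_adj_inr_inr {r : ℕ} (p : Fin r → ℕ) (x y : Σ i : Fin r, Fin (p i)) :
    ¬ (caterpillar r p).Adj (Sum.inr x) (Sum.inr y) := by
  simp [caterpillar]

lemma caterpillar_ncard_neighborSet_inr {r : ℕ} (p : Fin r → ℕ) (x : Σ i : Fin r, Fin (p i)) :
    ((caterpillar r p).neighborSet (Sum.inr x)).ncard = 1 := by
  rw [Set.ncard_eq_one]
  refine ⟨Sum.inl x.1, ?_⟩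
  ext (j | y)
  · simp [SimpleGraph.adj_comm _ (Sum.inr x), caterpillar_adj_inl_inr]
  · simp [caterpillar_not_adj_inr_inr]

lemma caterpillar_two_ncard_neighborSet_inl (i : Fin 2) :
    ((caterpillar 2 p).neighborSet (Sum.inl i)).ncard = p i + 1 := by
  have h : (caterpillar 2 p).neighborSet (Sum.inl i) =
      insert (Sum.inl (i + 1)) (Set.range fun k : Fin (p i) => Sum.inr ⟨i, k⟩) := by
    ext (j | ⟨j, k⟩)
    · simp only [SimpleGraph.mem_neighborSet, caterpillar_two_adj_inl_inl]
      fin_cases i <;> fin_cases j <;> simp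
    · simp only [SimpleGraph.mem_neighborSet, caterpillar_adj_inl_inr]
      constructor
      · rintro rfl
        simp
      · simp +contextual
  rw [h, Set.ncard_insert_of_notMem (by simp) (Set.finite_range _), ← Set.image_univ,
    Set.ncard_image_of_injective _ (fun a b hab => by simpa using hab), Set.ncard_univ,
    Nat.card_fin]

/-- The weight `1 / √d` of the `i`-th centre of the double star, where `d` is its degree. -/
noncomputable def doubleStarWeight (i : Fin 2) : ℝ := 1 / Real.sqrt ((p i : ℝ) + 1)

lemma natCast_mul_doubleStarWeight_sq (i : Fin 2) :
    (p i : ℝ) * doubleStarWeight p i ^ 2 = 1 - doubleStarWeight p i ^ 2 := by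
  have h : (0 : ℝ) < p i + 1 := by positivity
  rw [doubleStarWeight, div_pow, Real.sq_sqrt h.le]
  field_simp
  ring

lemma randicMatrix_caterpillar_two_inl_inl (i j : Fin 2) :
    randicMatrix (caterpillar 2 p) (Sum.inl i) (Sum.inl j) =
      if i = j then 0 else doubleStarWeight p i * doubleStarWeight p j := by
  by_cases hij : i = j <;>
    simp [randicMatrix, caterpillar_two_adj_inl_inl, caterpillar_two_ncard_neighborSet_inl,
      doubleStarWeight, hij, mul_comm]

lemma randicMatrix_caterpillar_two_inl_inr (i : Fin 2) (x : Σ i : Fin 2, Fin (p i)) :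
    randicMatrix (caterpillar 2 p) (Sum.inl i) (Sum.inr x) =
      if i = x.1 then doubleStarWeight p i else 0 := by
  simp [randicMatrix, caterpillar_adj_inl_inr, caterpillar_two_ncard_neighborSet_inl,
    caterpillar_ncard_neighborSet_inr, doubleStarWeight]

lemma randicMatrix_caterpillar_two_inr_inl (x : Σ i : Fin 2, Fin (p i)) (i : Fin 2) :
    randicMatrix (caterpillar 2 p) (Sum.inr x) (Sum.inl i) =
      if i = x.1 then doubleStarWeight p i else 0 := by
  rw [← randicMatrix_caterpillar_two_inl_inr]
  simpa using (randicMatrix_isHermitian (caterpillar 2 p)).apply (Sum.inl i) (Sum.inr x)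

lemma randicMatrix_caterpillar_inr_inr {r : ℕ} (p : Fin r → ℕ) (x y : Σ i : Fin r, Fin (p i)) :
    randicMatrix (caterpillar r p) (Sum.inr x) (Sum.inr y) = 0 := by
  simp [randicMatrix, caterpillar_not_adj_inr_inr]

lemma trace_randicMatrix_caterpillar_two_sq :
    (randicMatrix (caterpillar 2 p) ^ 2).trace =
      2 * (1 + (1 - doubleStarWeight p 0 ^ 2) * (1 - doubleStarWeight p 1 ^ 2)) := by
  have h0 := natCast_mul_doubleStarWeight_sq p 0
  have h1 := natCast_mul_doubleStarWeight_sq p 1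
  simp [pow_two, Matrix.trace, Matrix.mul_apply, Fintype.sum_sum_type, Fintype.sum_sigma,
    randicMatrix_caterpillar_two_inl_inl, randicMatrix_caterpillar_two_inl_inr,
    randicMatrix_caterpillar_two_inr_inl, randicMatrix_caterpillar_inr_inr]
  linear_combination 2 * h0 + 2 * h1

lemma trace_randicMatrix_caterpillar_two_pow_four :
    (randicMatrix (caterpillar 2 p) ^ 4).trace =
      2 * (1 + ((1 - doubleStarWeight p 0 ^ 2) * (1 - doubleStarWeight p 1 ^ 2)) ^ 2) := by
  have h0 := natCast_mul_doubleStarWeight_sq p 0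
  have h1 := natCast_mul_doubleStarWeight_sq p 1
  rw [show 4 = 2 + 2 from rfl, pow_add]
  simp [pow_two, Matrix.trace, Matrix.mul_apply, Fintype.sum_sum_type, Fintype.sum_sigma,
    randicMatrix_caterpillar_two_inl_inl, randicMatrix_caterpillar_two_inl_inr,
    randicMatrix_caterpillar_two_inr_inl, randicMatrix_caterpillar_inr_inr]
  generalize doubleStarWeight p 0 = a at *
  generalize doubleStarWeight p 1 = b at *
  linear_combination (2 * (p 0 * a ^ 2 + 1 - a ^ 2) + 4 * a ^ 2 * b ^ 2) * h0 +
    (2 * (p 1 * b ^ 2 + 1 - b ^ 2) + 4 * a ^ 2 * b ^ 2) * h1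

lemma randicMatrix_caterpillar_two_eigenvalue {t : ℝ}
    {x : Fin 2 ⊕ (Σ i : Fin 2, Fin (p i)) → ℝ} (hx : x ≠ 0)
    (h : (randicMatrix (caterpillar 2 p)).mulVec x = t • x) :
    t = 0 ∨ t ^ 2 = 1 ∨
      t ^ 2 = (1 - doubleStarWeight p 0 ^ 2) * (1 - doubleStarWeight p 1 ^ 2) := by
  have h0 := natCast_mul_doubleStarWeight_sq p 0
  have h1 := natCast_mul_doubleStarWeight_sq p 1
  by_cases ht : t = 0
  · exact .inl ht
  refine .inr ?_
  have hleaf (i : Fin 2) (k : Fin (p i)) :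
      x (Sum.inr ⟨i, k⟩) = doubleStarWeight p i * x (Sum.inl i) / t := by
    have := congrFun h (Sum.inr ⟨i, k⟩)
    rw [eq_div_iff ht]
    simpa [Matrix.mulVec, dotProduct, Fintype.sum_sum_type, mul_comm, eq_comm,
      randicMatrix_caterpillar_two_inr_inl, randicMatrix_caterpillar_inr_inr] using this
  have e0 := congrFun h (Sum.inl 0)
  have e1 := congrFun h (Sum.inl 1)
  simp [Matrix.mulVec, dotProduct, Fintype.sum_sum_type, Fintype.sum_sigma, hleaf,
      randicMatrix_caterpillar_two_inl_inl, randicMatrix_caterpillar_two_inl_inr] at e0 e1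
  have hc : x (Sum.inl 0) ≠ 0 ∨ x (Sum.inl 1) ≠ 0 := by
    by_contra! hc
    refine hx (funext ?_)
    rintro (i | ⟨i, k⟩)
    · fin_cases i <;> simp [hc]
    · rw [hleaf]
      fin_cases i <;> simp [hc]
  generalize doubleStarWeight p 0 = a at *
  generalize doubleStarWeight p 1 = b at *
  generalize x (Sum.inl 0) = y at *
  generalize x (Sum.inl 1) = z at *
  field_simp at e0 e1
  have f0 : (t ^ 2 - (1 - a ^ 2)) * y = t * a * b * z := by
    linear_combination -e0 + y * h0
  have f1 : (t ^ 2 - (1 - b ^ 2)) * z = t * a * b * y := by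
    linear_combination -e1 + z * h1
  have key : (t ^ 2 - 1) * (t ^ 2 - (1 - a ^ 2) * (1 - b ^ 2)) = 0 := by
    rcases hc with hc | hc
    · refine (mul_eq_zero.1 ?_).resolve_right hc
      linear_combination (t ^ 2 - (1 - b ^ 2)) * f0 + t * a * b * f1
    · refine (mul_eq_zero.1 ?_).resolve_right hc
      linear_combination (t ^ 2 - (1 - a ^ 2)) * f1 + t * a * b * f0
  rcases mul_eq_zero.1 key with h | h
  · exact .inl (sub_eq_zero.1 h)
  · exact .inr (sub_eq_zero.1 h)

theorem randicEnergy_caterpillar_two (hp : ∀ i, 0 < p i) :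
    randicEnergy (caterpillar 2 p) =
      2 + 2 * Real.sqrt ((p 0 * p 1 : ℝ) / ((p 0 + 1) * (p 1 + 1))) := by
  have hw (i : Fin 2) : 1 - doubleStarWeight p i ^ 2 = (p i : ℝ) / (p i + 1) := by
    rw [eq_div_iff (by positivity)]
    linear_combination -natCast_mul_doubleStarWeight_sq p i
  have hs2 : (1 - doubleStarWeight p 0 ^ 2) * (1 - doubleStarWeight p 1 ^ 2) =
      (p 0 * p 1 : ℝ) / ((p 0 + 1) * (p 1 + 1)) := by
    rw [hw, hw, div_mul_div_comm]
  have hpos : (0 : ℝ) < (p 0 * p 1 : ℝ) / ((p 0 + 1) * (p 1 + 1)) := by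
    have := hp 0
    have := hp 1
    positivity
  set s := Real.sqrt ((p 0 * p 1 : ℝ) / ((p 0 + 1) * (p 1 + 1)))
  have hs : 0 < s := Real.sqrt_pos.2 hpos
  have hss : (1 - doubleStarWeight p 0 ^ 2) * (1 - doubleStarWeight p 1 ^ 2) = s ^ 2 := by
    rw [hs2, Real.sq_sqrt hpos.le]
  have hA := randicMatrix_isHermitian (caterpillar 2 p)
  -- Even quartic interpolation of `|t|` at the eigenvalues `0`, `±1`, `±s`.
  have habs (i) : s * (1 + s) * |hA.eigenvalues i| =
      (1 + s + s ^ 2) * hA.eigenvalues i ^ 2 - hA.eigenvalues i ^ 4 := by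
    have hev := randicMatrix_caterpillar_two_eigenvalue p (t := hA.eigenvalues i)
      (x := (hA.eigenvectorBasis i).ofLp)
      (fun h => hA.eigenvectorBasis.toBasis.ne_zero i (by ext j; simpa using congrFun h j))
      (hA.mulVec_eigenvectorBasis i)
    rw [hss] at hev
    rw [← sq_abs (hA.eigenvalues i), show hA.eigenvalues i ^ 4 = |hA.eigenvalues i| ^ 4 by
      rw [Even.pow_abs (by decide)]]
    have : |hA.eigenvalues i| = 0 ∨ |hA.eigenvalues i| = 1 ∨ |hA.eigenvalues i| = s := by
      rcases hev with h | h | h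
      · simp [h]
      · exact .inr (.inl ((sq_eq_sq₀ (abs_nonneg _) zero_le_one).1 (by simpa using h)))
      · exact .inr (.inr ((sq_eq_sq₀ (abs_nonneg _) hs.le).1 (by simpa using h)))
    rcases this with h | h | h <;> rw [h] <;> ring
  refine mul_left_cancel₀ (mul_pos hs (by linarith : 0 < 1 + s)).ne' ?_
  rw [randicEnergy, Finset.mul_sum, Finset.sum_congr rfl fun i _ => habs i,
    Finset.sum_sub_distrib, ← Finset.mul_sum, ← hA.trace_pow_eq_sum_eigenvalues_pow,
    ← hA.trace_pow_eq_sum_eigenvalues_pow, trace_randicMatrix_caterpillar_two_sq,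
    trace_randicMatrix_caterpillar_two_pow_four, hss]
  ring

end DoubleStar

/-- For `n ≥ 4`, `1 ≤ p ≤ n - 3` and `q = n - p - 2`, the Randić energy of the
double star `T(p, q)` equals `2 + 2√(p(n-p-2)/((p+1)(n-p-1)))`. -/
theorem doubleStar_randicEnergy (n p : ℕ) (hn : 4 ≤ n) (hp1 : 1 ≤ p) (hp2 : p ≤ n - 3) :
    randicEnergy (caterpillar 2 ![p, n - p - 2])
      = 2 + 2 * Real.sqrt (((p : ℝ) * ((n : ℝ) - p - 2)) /
          ((((p : ℝ) + 1)) * ((n : ℝ) - p - 1))) := by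
  have hq : ((n - p - 2 : ℕ) : ℝ) = (n : ℝ) - p - 2 := by
    rw [Nat.cast_sub (by omega), Nat.cast_sub (by omega)]
    norm_num
  have hpos : ∀ i, 0 < (![p, n - p - 2] : Fin 2 → ℕ) i := by
    intro i
    fin_cases i
    · exact hp1
    · change 0 < n - p - 2
      omega
  rw [randicEnergy_caterpillar_two _ hpos]
  simp only [Matrix.cons_val_zero, Matrix.cons_val_one, hq]
  rw [show (n : ℝ) - p - 2 + 1 = n - p - 1 by ring]
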